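/- arXiv:1311.2355 — 9 statements merged into one kernel-verified Lean document; each statement's English description precedes it below -/
import Mathlib

section
/- Let G = (V,E) be a finite connected graph and ℓ : V → {0,1} a labelling of odd weight, and let κ ≥ 1. Suppose there is a set T ⊆ V with |T| = 2κ+1 such that for every set M of κ pairwise disjoint pairs of nodes of T there exist κ pairwise edge-disjoint paths in G, one connecting each pair of M. Then for every total function f with f(α) ∈ Viol(α) for all α : E → {0,1}, there exists an assignment α with |Viol(α)| = 1 such that the block sensitivity of f at α is at least 2κ/3. In particular the critical block sensitivity of the Tseitin search problem S(Tse_G) is at least 2κ/3. -/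
/-- The set of violated nodes of the Tseitin formula `Tse_G` (with labelling `ℓ`)
under the assignment `α : E → {0,1}`. -/
def tseitinViol {V : Type*} [Fintype V] [DecidableEq V] (G : SimpleGraph V)
    [DecidableRel G.Adj] (ℓ : V → ZMod 2) (α : G.edgeSet → ZMod 2) : Finset V :=
  Finset.univ.filter fun v =>
    (∑ e : G.edgeSet, if v ∈ (e : Sym2 V) then α e else 0) ≠ ℓ v

open Finset

/-- The boundary (parity at every node) of an edge assignment. -/
def tsBd {V : Type*} [Fintype V] [DecidableEq V] (G : SimpleGraph V)
    [DecidableRel G.Adj] (α : G.edgeSet → ZMod 2) (v : V) : ZMod 2 :=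
  ∑ e : G.edgeSet, if v ∈ (e : Sym2 V) then α e else 0

/-- Indicator of a node. -/
def tsDelta {V : Type*} [DecidableEq V] (u : V) (v : V) : ZMod 2 := if v = u then 1 else 0

/-- The mod 2 edge chain of a walk. -/
def tsChain {V : Type*} [DecidableEq V] {G : SimpleGraph V}
    {u v : V} (W : G.Walk u v) (e : G.edgeSet) : ZMod 2 := (W.edges.count (e : Sym2 V) : ZMod 2)

section
variable {V : Type*} [Fintype V] [DecidableEq V] (G : SimpleGraph V) [DecidableRel G.Adj]

lemma tsBd_add (α β : G.edgeSet → ZMod 2) (v : V) :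
    tsBd G (α + β) v = tsBd G α v + tsBd G β v := by
  unfold tsBd
  rw [← Finset.sum_add_distrib]
  refine Finset.sum_congr rfl fun e _ => ?_
  split_ifs <;> simp

lemma tsBd_zero (v : V) : tsBd G 0 v = 0 := by
  simp [tsBd]

lemma tsBd_sum {ι : Type*} (s : Finset ι) (α : ι → G.edgeSet → ZMod 2) (v : V) :
    tsBd G (∑ i ∈ s, α i) v = ∑ i ∈ s, tsBd G (α i) v := by
  classical
  induction s using Finset.induction_on with
  | empty => simp [tsBd_zero]
  | insert a s ha ih => rw [Finset.sum_insert ha, Finset.sum_insert ha, tsBd_add, ih]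

lemma tsBd_smul (c : ZMod 2) (α : G.edgeSet → ZMod 2) (v : V) :
    tsBd G (c • α) v = c * tsBd G α v := by
  unfold tsBd
  rw [Finset.mul_sum]
  refine Finset.sum_congr rfl fun e _ => ?_
  split_ifs <;> simp

lemma zmod2_add_self (x : ZMod 2) : x + x = 0 := CharTwo.add_self_eq_zero x

lemma tsBd_chain {u v : V} (W : G.Walk u v) (w : V) :
    tsBd G (tsChain W) w = tsDelta u w + tsDelta v w := by
  induction W with
  | nil => simp [tsBd, tsChain, zmod2_add_self]
  | @cons a b c h W ih =>
    have h1 : tsChain (SimpleGraph.Walk.cons h W)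
        = tsChain W + (fun e : G.edgeSet => if e = ⟨s(a,b), h⟩ then (1 : ZMod 2) else 0) := by
      funext e
      simp only [tsChain, SimpleGraph.Walk.edges_cons, List.count_cons, Pi.add_apply]
      by_cases he : e = ⟨s(a,b), h⟩
      · subst he; simp
      · have : ¬ (s(a,b) = (e : Sym2 V)) := fun h' => he (Subtype.ext h'.symm)
        simp [he, this]
    rw [h1, tsBd_add, ih]
    have h2 : tsBd G (fun e : G.edgeSet => if e = ⟨s(a,b), h⟩ then (1 : ZMod 2) else 0) w
        = tsDelta a w + tsDelta b w := by
      unfold tsBd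
      rw [Finset.sum_eq_single (⟨s(a,b), h⟩ : G.edgeSet)]
      · have hab : a ≠ b := h.ne
        simp only [Sym2.mem_iff, tsDelta]
        by_cases h1 : w = a
        · have : w ≠ b := fun h' => hab (h1.symm.trans h')
          simp [h1, hab]
        · simp [h1]
      · intro e _ he; simp [he]
      · simp
    rw [h2]
    have := zmod2_add_self (tsDelta b w)
    linear_combination this

/-- Every even-weight target is a boundary. -/
lemma ts_exists_bd (hconn : G.Connected) (t : V → ZMod 2) (ht : ∑ v, t v = 0) :
    ∃ α, ∀ w, tsBd G α w = t w := by
  obtain ⟨r⟩ := hconn.nonempty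
  have hW : ∀ u : V, ∃ _ : G.Walk u r, True := fun u => by
    obtain ⟨W⟩ := hconn.preconnected u r
    exact ⟨W, trivial⟩
  choose W _ using hW
  refine ⟨∑ u, t u • tsChain (W u), fun w => ?_⟩
  rw [tsBd_sum]
  simp only [tsBd_smul, tsBd_chain, mul_add, Finset.sum_add_distrib]
  rw [← Finset.sum_mul, ht]
  simp [tsDelta]

lemma ts_mem_viol (ℓ : V → ZMod 2) (α : G.edgeSet → ZMod 2) (v : V) :
    v ∈ tseitinViol G ℓ α ↔ tsBd G α v ≠ ℓ v := by
  simp [tseitinViol, tsBd]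

lemma ts_flip {u v : V} (W : G.Walk u v) (hW : W.IsPath) (α : G.edgeSet → ZMod 2) :
    (fun e => if e ∈ (univ.filter fun e : G.edgeSet => (e : Sym2 V) ∈ W.edges)
      then α e + 1 else α e) = α + tsChain W := by
  funext e
  have hn : W.edges.Nodup := hW.isTrail.edges_nodup
  simp only [mem_filter, mem_univ, true_and, Pi.add_apply, tsChain]
  split_ifs with h
  · rw [List.count_eq_one_of_mem hn h]; simp
  · rw [List.count_eq_zero_of_not_mem h]; simp

end

section
variable {V : Type*} [Fintype V] [DecidableEq V] (G : SimpleGraph V) [DecidableRel G.Adj]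

/-- Assignments with violations exactly at three given nodes (mod 2). -/
def tsTri (ℓ : V → ZMod 2) (a b c : V) : Finset (G.edgeSet → ZMod 2) :=
  univ.filter fun β => ∀ w, tsBd G β w = ℓ w + tsDelta a w + tsDelta b w + tsDelta c w

/-- Assignments with violation exactly at one node. -/
def tsOne (ℓ : V → ZMod 2) (a : V) : Finset (G.edgeSet → ZMod 2) :=
  univ.filter fun β => ∀ w, tsBd G β w = ℓ w + tsDelta a w

lemma ts_one_tri (ℓ : V → ZMod 2) (a : V) {b c : V} (W : G.Walk b c)
    (p : (G.edgeSet → ZMod 2) → Prop) [DecidablePred p] :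
    ((tsOne G ℓ a).filter fun α => p (α + tsChain W)).card
      = ((tsTri G ℓ a b c).filter p).card := by
  have hself : ∀ α : G.edgeSet → ZMod 2, α + tsChain W + tsChain W = α := by
    intro α
    funext e
    simp only [Pi.add_apply]
    rw [add_assoc, zmod2_add_self, add_zero]
  refine Finset.card_nbij' (fun α => α + tsChain W) (fun α => α + tsChain W) ?_ ?_ ?_ ?_
  · intro α hα
    simp only [tsOne, tsTri, coe_filter, mem_filter, mem_univ, true_and, Set.mem_ofPred_eq] at hα ⊢
    refine ⟨fun w => ?_, hα.2⟩
    rw [tsBd_add, hα.1, tsBd_chain]; ring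
  · intro α hα
    simp only [tsOne, tsTri, coe_filter, mem_filter, mem_univ, true_and, Set.mem_ofPred_eq] at hα ⊢
    refine ⟨fun w => ?_, by rw [hself]; exact hα.2⟩
    rw [tsBd_add, hα.1, tsBd_chain]
    linear_combination zmod2_add_self (tsDelta b w) + zmod2_add_self (tsDelta c w)
  · intro α _; exact hself α
  · intro α _; exact hself α

lemma ts_one_viol (ℓ : V → ZMod 2) (a : V) (α) (h : α ∈ tsOne G ℓ a) :
    tseitinViol G ℓ α = {a} := by
  ext w
  simp only [tsOne, mem_filter, mem_univ, true_and] at h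
  rw [ts_mem_viol, h w, Finset.mem_singleton, tsDelta]
  split_ifs with hw <;> simp [hw]

lemma ts_tri_count (ℓ : V → ZMod 2) {a b c : V} (hab : a ≠ b) (hac : a ≠ c) (hbc : b ≠ c)
    (f : (G.edgeSet → ZMod 2) → V) (hf : ∀ α, f α ∈ tseitinViol G ℓ α) :
    ((tsTri G ℓ a b c).filter fun β => f β ≠ a).card
      + ((tsTri G ℓ a b c).filter fun β => f β ≠ b).card
      + ((tsTri G ℓ a b c).filter fun β => f β ≠ c).card = 2 * (tsTri G ℓ a b c).card := by
  simp only [Finset.card_filter]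
  rw [← Finset.sum_add_distrib, ← Finset.sum_add_distrib, mul_comm, ← smul_eq_mul,
    ← Finset.sum_const]
  refine Finset.sum_congr rfl fun β hβ => ?_
  simp only [tsTri, mem_filter, mem_univ, true_and] at hβ
  have h := hf β
  rw [ts_mem_viol, hβ] at h
  have h3 : f β = a ∨ f β = b ∨ f β = c := by
    by_contra hcon
    push Not at hcon
    apply h
    simp [tsDelta, hcon.1, hcon.2.1, hcon.2.2]
  rcases h3 with h3 | h3 | h3 <;> rw [h3]
  · simp [hab, hac]
  · simp [hab.symm, hbc]
  · simp [hac.symm, hbc.symm]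

lemma ts_tri_perm1 (ℓ : V → ZMod 2) (a b c : V) : tsTri G ℓ b a c = tsTri G ℓ a b c := by
  ext β
  simp only [tsTri, mem_filter, mem_univ, true_and]
  refine forall_congr' fun w => ?_
  rw [show ℓ w + tsDelta b w + tsDelta a w + tsDelta c w
    = ℓ w + tsDelta a w + tsDelta b w + tsDelta c w by ring]

lemma ts_tri_perm2 (ℓ : V → ZMod 2) (a b c : V) : tsTri G ℓ c b a = tsTri G ℓ a b c := by
  ext β
  simp only [tsTri, mem_filter, mem_univ, true_and]
  refine forall_congr' fun w => ?_
  rw [show ℓ w + tsDelta c w + tsDelta b w + tsDelta a w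
    = ℓ w + tsDelta a w + tsDelta b w + tsDelta c w by ring]

lemma ts_sum_swap {X Y : Type*} [Fintype X] [Fintype Y] [DecidableEq X] [DecidableEq Y]
    (x y : X) (F : (X ≃ Y) → ℕ) :
    ∑ σ : X ≃ Y, F ((Equiv.swap x y).trans σ) = ∑ σ : X ≃ Y, F σ := by
  have hs : ∀ σ : X ≃ Y, (Equiv.swap x y).trans ((Equiv.swap x y).trans σ) = σ := by
    intro σ; ext z; simp
  exact Finset.sum_nbij' (fun σ => (Equiv.swap x y).trans σ) (fun σ => (Equiv.swap x y).trans σ)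
    (by simp) (by simp) (fun σ _ => hs σ) (fun σ _ => hs σ) (fun σ _ => rfl)

end

/-- **Tseitin sensitivity.** Let `G` be a finite connected graph with an odd-weight
labelling `ℓ`, and suppose there is a set `T` of `2κ+1` nodes such that every
collection `M` of `κ` pairwise disjoint pairs of nodes of `T` can be connected by
`κ` pairwise edge-disjoint paths.  Then every total function `f` solving the Tseitin
search problem `S(Tse_G)` has a critical input `α` (exactly one violated node) with
block sensitivity at least `2κ/3`: there are `b ≥ 2κ/3` pairwise disjoint nonempty
blocks of edges, flipping any one of which changes the value of `f`.
Hence `bs_crit(S(Tse_G)) ≥ 2κ/3`. -/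
theorem stmt2 {V : Type*} [Fintype V] [DecidableEq V] (G : SimpleGraph V)
    [DecidableRel G.Adj] (hconn : G.Connected)
    (ℓ : V → ZMod 2) (hℓ : (∑ v : V, ℓ v) = 1)
    (κ : ℕ) (hκ : 1 ≤ κ) (T : Finset V) (hT : T.card = 2 * κ + 1)
    (hroute : ∀ M : Fin κ → V × V,
      (∀ i, (M i).1 ∈ T ∧ (M i).2 ∈ T) →
      Function.Injective
        (fun p : Fin κ × Bool => if p.2 then (M p.1).1 else (M p.1).2) →
      ∃ P : (i : Fin κ) → G.Walk (M i).1 (M i).2,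
        (∀ i, (P i).IsPath) ∧
        ∀ i j, i ≠ j → List.Disjoint (P i).edges (P j).edges)
    (f : (G.edgeSet → ZMod 2) → V)
    (hf : ∀ α, f α ∈ tseitinViol G ℓ α) :
    ∃ α : G.edgeSet → ZMod 2, (tseitinViol G ℓ α).card = 1 ∧
      ∃ (b : ℕ) (B : Fin b → Finset G.edgeSet),
        2 * κ ≤ 3 * b ∧
        (∀ i, (B i).Nonempty) ∧
        (∀ i j, i ≠ j → Disjoint (B i) (B j)) ∧
        (∀ i, f (fun e => if e ∈ B i then α e + 1 else α e) ≠ f α) := by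
  classical
  have hcard : Fintype.card (Option (Fin κ × Bool)) = Fintype.card {x // x ∈ T} := by
    simp [hT]; ring
  have key : ∀ σ : Option (Fin κ × Bool) ≃ {x // x ∈ T},
      ∃ P : (i : Fin κ) → G.Walk (σ (some (i, true)) : V) (σ (some (i, false)) : V),
        (∀ i, (P i).IsPath) ∧ ∀ i j, i ≠ j → List.Disjoint (P i).edges (P j).edges := by
    intro σ
    refine hroute (fun i => ((σ (some (i, true)) : V), (σ (some (i, false)) : V)))
      (fun i => ⟨(σ _).2, (σ _).2⟩) ?_
    have he : (fun p : Fin κ × Bool => if p.2 then (σ (some (p.1, true)) : V)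
        else (σ (some (p.1, false)) : V)) = fun p => (σ (some p) : V) := by
      funext ⟨i, b⟩
      cases b <;> simp
    show Function.Injective (fun p : Fin κ × Bool => if p.2 then (σ (some (p.1, true)) : V)
        else (σ (some (p.1, false)) : V))
    rw [he]
    intro p q hpq
    exact Option.some_injective _ (σ.injective (Subtype.ext hpq))
  choose P hP hdisj using key
  by_contra hcon
  -- sensitive paths are few
  have hfew : ∀ σ, ∀ α ∈ tsOne G ℓ (σ none : V),
      3 * (univ.filter fun i => f (α + tsChain (P σ i)) ≠ (σ none : V)).card < 2 * κ := by
    intro σ α hα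
    by_contra hlt
    push Not at hlt
    apply hcon
    have hv := ts_one_viol G ℓ _ α hα
    have hfα : f α = (σ none : V) := by
      have := hf α
      rwa [hv, Finset.mem_singleton] at this
    refine ⟨α, by rw [hv]; simp, ?_⟩
    set S := univ.filter fun i => f (α + tsChain (P σ i)) ≠ (σ none : V) with hS
    let en := S.equivFin.symm
    have hen : ∀ j, f (α + tsChain (P σ (en j))) ≠ (σ none : V) := fun j =>
      (mem_filter.mp (en j).2).2
    refine ⟨S.card, fun j => univ.filter fun e : G.edgeSet =>
      (e : Sym2 V) ∈ (P σ (en j)).edges, hlt, ?_, ?_, ?_⟩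
    · intro j
      by_contra hne
      rw [Finset.not_nonempty_iff_eq_empty] at hne
      have h1 := ts_flip G (P σ (en j)) (hP σ _) α
      beta_reduce at hne
      rw [hne] at h1
      have h2 := hen j
      rw [← h1] at h2
      apply h2
      simpa using hfα
    · intro i j hij
      rw [Finset.disjoint_left]
      intro e h1 h2
      simp only [mem_filter, mem_univ, true_and] at h1 h2
      refine hdisj σ (en i) (en j) (fun h => hij (en.injective (Subtype.ext h))) h1 h2
    · intro j
      rw [ts_flip G _ (hP σ _) α, hfα]
      exact hen j
  -- double counting
  let A : (Option (Fin κ × Bool) ≃ {x // x ∈ T}) → Finset (G.edgeSet → ZMod 2) :=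
    fun σ => tsOne G ℓ (σ none : V)
  let g : Fin κ → (Option (Fin κ × Bool) ≃ {x // x ∈ T}) → ℕ := fun i σ =>
    ((tsTri G ℓ (σ none : V) (σ (some (i, true))) (σ (some (i, false)))).filter
      fun β => f β ≠ (σ none : V)).card
  have hA : ∀ i σ, (tsTri G ℓ (σ none : V) (σ (some (i, true))) (σ (some (i, false)))).card
      = (A σ).card := by
    intro i σ
    have := ts_one_tri G ℓ (σ none : V) (P σ i) (fun _ => True)
    simpa using this.symm
  have hg : ∀ i, 3 * ∑ σ, g i σ = 2 * ∑ σ, (A σ).card := by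
    intro i
    have e1 := ts_sum_swap none (some (i, true)) (g i)
    have e2 := ts_sum_swap none (some (i, false)) (g i)
    have : 3 * ∑ σ, g i σ = ∑ σ, (g i σ + g i ((Equiv.swap none (some (i, true))).trans σ)
        + g i ((Equiv.swap none (some (i, false))).trans σ)) := by
      rw [Finset.sum_add_distrib, Finset.sum_add_distrib, e1, e2]; ring
    rw [this, Finset.mul_sum]
    refine Finset.sum_congr rfl fun σ _ => ?_
    rw [← hA i σ]
    have hne : ∀ x y, x ≠ y → (σ x : V) ≠ (σ y : V) :=
      fun x y hxy h => hxy (σ.injective (Subtype.ext h))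
    rw [← ts_tri_count G ℓ (hne none (some (i, true)) (by simp))
      (hne none (some (i, false)) (by simp)) (hne (some (i, true)) (some (i, false)) (by simp)) f hf]
    have s1 : Equiv.swap none (some (i, true)) (some (i, false)) = some (i, false) :=
      Equiv.swap_apply_of_ne_of_ne (by simp) (by simp)
    have s2 : Equiv.swap none (some (i, false)) (some (i, true)) = some (i, true) :=
      Equiv.swap_apply_of_ne_of_ne (by simp) (by simp)
    simp only [g, Equiv.trans_apply, Equiv.swap_apply_left, Equiv.swap_apply_right, s1, s2]
    rw [ts_tri_perm1 G ℓ (σ none : V) (σ (some (i, true))),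
      ts_tri_perm2 G ℓ (σ none : V) (σ (some (i, true))) (σ (some (i, false)))]
  have hdc : ∑ i, ∑ σ, g i σ
      = ∑ σ, ∑ α ∈ A σ, (univ.filter fun i => f (α + tsChain (P σ i)) ≠ (σ none : V)).card := by
    rw [Finset.sum_comm]
    refine Finset.sum_congr rfl fun σ _ => ?_
    simp only [Finset.card_filter]
    rw [Finset.sum_comm]
    refine Finset.sum_congr rfl fun i _ => ?_
    rw [← Finset.card_filter]
    exact (ts_one_tri G ℓ (σ none : V) (P σ i) (fun β => f β ≠ (σ none : V))).symm
  have htot : 3 * ∑ i, ∑ σ, g i σ = ∑ σ, ∑ α ∈ A σ, 2 * κ := by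
    rw [Finset.mul_sum, Finset.sum_congr rfl fun i _ => hg i]
    simp only [Finset.sum_const, smul_eq_mul, Finset.card_univ, Fintype.card_fin]
    rw [← Finset.sum_mul]; ring
  rw [hdc, Finset.mul_sum] at htot
  refine absurd htot (ne_of_lt ?_)
  have hnon : ∀ σ, (A σ).Nonempty := by
    intro σ
    obtain ⟨α, hα⟩ := ts_exists_bd G hconn (fun w => ℓ w + tsDelta (σ none : V) w) (by
      rw [Finset.sum_add_distrib, hℓ]
      simp [tsDelta, zmod2_add_self])
    exact ⟨α, by simpa [A, tsOne] using hα⟩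
  refine Finset.sum_lt_sum_of_nonempty ⟨Fintype.equivOfCardEq hcard, mem_univ _⟩ fun σ _ => ?_
  rw [Finset.mul_sum]
  exact Finset.sum_lt_sum_of_nonempty (hnon σ) fun α hα => hfew σ α hα
end

section
/- Let m ≥ 3 and let G be the m × m grid graph on vertex set {1,…,m} × {1,…,m} (two vertices adjacent iff they differ by 1 in exactly one coordinate). Let T = {(1,j) : j ∈ {1,…,m}} be the first row. Then for every set M of κ = ⌊m/2⌋ pairwise disjoint pairs of vertices of T, there exist κ pairwise edge-disjoint paths in G, one connecting each pair of M. Hence the m × m grid graph is ⌊m/2⌋-routable. -/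
/-- The `m × m` grid graph: vertices are pairs in `Fin m × Fin m`, and two vertices
are adjacent iff they differ by `1` in exactly one coordinate. -/
def gridGraph (m : ℕ) : SimpleGraph (Fin m × Fin m) :=
  SimpleGraph.fromRel fun u v =>
    (u.1 = v.1 ∧ u.2.val + 1 = v.2.val) ∨ (u.2 = v.2 ∧ u.1.val + 1 = v.1.val)

theorem lineWalk {V : Type*} (G : SimpleGraph V) (m : ℕ) (f : Fin m → V)
    (hf : ∀ (k : ℕ) (h : k + 1 < m), G.Adj (f ⟨k, by omega⟩) (f ⟨k + 1, h⟩))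
    (a b : Fin m) : ∃ p : G.Walk (f a) (f b), ∀ e ∈ p.edges, ∀ v ∈ e, ∃ k, v = f k := by
  have key : ∀ (k : ℕ) (h : k < m), ∃ p : G.Walk (f ⟨0, by omega⟩) (f ⟨k, h⟩),
      ∀ e ∈ p.edges, ∀ v ∈ e, ∃ k, v = f k := by
    intro k
    induction k with
    | zero => intro h; exact ⟨SimpleGraph.Walk.nil, by simp⟩
    | succ k ih =>
      intro h
      obtain ⟨p, hp⟩ := ih (by omega)
      refine ⟨p.concat (hf k h), ?_⟩
      intro e he v hv
      rw [SimpleGraph.Walk.edges_concat, List.concat_eq_append, List.mem_append,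
        List.mem_singleton] at he
      rcases he with he | rfl
      · exact hp e he v hv
      · rcases Sym2.mem_iff.1 hv with h | h
        · exact ⟨_, h⟩
        · exact ⟨_, h⟩
  obtain ⟨p, hp⟩ := key a.1 a.2
  obtain ⟨q, hq⟩ := key b.1 b.2
  refine ⟨p.reverse.append q, ?_⟩
  intro e he
  rw [SimpleGraph.Walk.edges_append, List.mem_append, SimpleGraph.Walk.edges_reverse,
    List.mem_reverse] at he
  exact he.elim (hp e) (hq e)

theorem rowWalk (m : ℕ) (r a b : Fin m) :
    ∃ p : (gridGraph m).Walk (r, a) (r, b), ∀ e ∈ p.edges, ∀ v ∈ e, v.1 = r := by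
  obtain ⟨p, hp⟩ := lineWalk (gridGraph m) m (fun k => (r, k))
    (by intro k h; simp [gridGraph]) a b
  refine ⟨p, fun e he v hv => ?_⟩
  obtain ⟨k, rfl⟩ := hp e he v hv
  rfl

theorem colWalk (m : ℕ) (c a b : Fin m) :
    ∃ p : (gridGraph m).Walk (a, c) (b, c), ∀ e ∈ p.edges, ∀ v ∈ e, v.2 = c := by
  obtain ⟨p, hp⟩ := lineWalk (gridGraph m) m (fun k => (k, c))
    (by intro k h; simp [gridGraph]) a b
  refine ⟨p, fun e he v hv => ?_⟩
  obtain ⟨k, rfl⟩ := hp e he v hv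
  rfl

theorem pairWalk (m : ℕ) (z r : Fin m) (x y : Fin m × Fin m) (hx : x.1 = z) (hy : y.1 = z) :
    ∃ p : (gridGraph m).Walk x y, p.IsPath ∧ ∀ e ∈ p.edges,
      (∀ v ∈ e, v.1 = r) ∨ (∀ v ∈ e, v.2 = x.2) ∨ (∀ v ∈ e, v.2 = y.2) := by
  classical
  obtain ⟨x1, a⟩ := x
  obtain ⟨y1, b⟩ := y
  obtain ⟨p, hp⟩ := colWalk m a x1 r
  obtain ⟨q, hq⟩ := rowWalk m r a b
  obtain ⟨s, hs⟩ := colWalk m b r y1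
  refine ⟨((p.append q).append s).bypass, SimpleGraph.Walk.bypass_isPath _, ?_⟩
  intro e he
  have he := SimpleGraph.Walk.edges_bypass_subset _ he
  rw [SimpleGraph.Walk.edges_append, List.mem_append, SimpleGraph.Walk.edges_append,
    List.mem_append] at he
  rcases he with (he | he) | he
  · exact Or.inr (Or.inl (hp e he))
  · exact Or.inl (hq e he)
  · exact Or.inr (Or.inr (hs e he))

/-- The `m × m` grid graph is `⌊m/2⌋`-routable with terminal set the first row:
for every collection `M` of `⌊m/2⌋` pairwise disjoint pairs of vertices of the first
row there are `⌊m/2⌋` pairwise edge-disjoint paths, one connecting each pair. -/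
theorem stmt3 (m : ℕ) (hm : 3 ≤ m)
    (M : Fin (m / 2) → (Fin m × Fin m) × (Fin m × Fin m))
    (hT : ∀ i, (M i).1.1 = ⟨0, by omega⟩ ∧ (M i).2.1 = ⟨0, by omega⟩)
    (hinj : Function.Injective
      (fun p : Fin (m / 2) × Bool => if p.2 then (M p.1).1 else (M p.1).2)) :
    ∃ P : (i : Fin (m / 2)) → (gridGraph m).Walk (M i).1 (M i).2,
      (∀ i, (P i).IsPath) ∧
      ∀ i j, i ≠ j → List.Disjoint (P i).edges (P j).edges := by
  have hw := fun i : Fin (m / 2) =>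
    pairWalk m ⟨0, by omega⟩ ⟨i.1, by omega⟩ (M i).1 (M i).2 (hT i).1 (hT i).2
  choose P hP hE using hw
  refine ⟨P, hP, ?_⟩
  intro i j hij e hi hj
  have hadj := (P i).edges_subset_edgeSet hi
  have h1 := hE i e hi
  have h2 := hE j e hj
  have n11 : (M i).1.2 ≠ (M j).1.2 := fun h => hij (congrArg Prod.fst
    (@hinj (i, true) (j, true) (Prod.ext ((hT i).1.trans (hT j).1.symm) h)))
  have n12 : (M i).1.2 ≠ (M j).2.2 := fun h => hij (congrArg Prod.fst
    (@hinj (i, true) (j, false) (Prod.ext ((hT i).1.trans (hT j).2.symm) h)))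
  have n21 : (M i).2.2 ≠ (M j).1.2 := fun h => hij (congrArg Prod.fst
    (@hinj (i, false) (j, true) (Prod.ext ((hT i).2.trans (hT j).1.symm) h)))
  have n22 : (M i).2.2 ≠ (M j).2.2 := fun h => hij (congrArg Prod.fst
    (@hinj (i, false) (j, false) (Prod.ext ((hT i).2.trans (hT j).2.symm) h)))
  have hr : (⟨i.1, by omega⟩ : Fin m) ≠ ⟨j.1, by omega⟩ := fun h =>
    hij (Fin.ext (by simpa using h))
  induction e using Sym2.ind with
  | _ u v =>
    have hne : u ≠ v := (SimpleGraph.mem_edgeSet _ |>.1 hadj).ne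
    have hne' : u.1 = v.1 → u.2 = v.2 → False := fun a b => hne (Prod.ext a b)
    simp only [Sym2.mem_iff, forall_eq_or_imp, forall_eq] at h1 h2
    rcases h1 with ⟨a, b⟩ | ⟨a, b⟩ | ⟨a, b⟩ <;> rcases h2 with ⟨c, d⟩ | ⟨c, d⟩ | ⟨c, d⟩
    · exact hr (a.symm.trans c)
    · exact hne' (a.trans b.symm) (c.trans d.symm)
    · exact hne' (a.trans b.symm) (c.trans d.symm)
    · exact hne' (c.trans d.symm) (a.trans b.symm)
    · exact n11 (a.symm.trans c)
    · exact n12 (a.symm.trans c)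
    · exact hne' (c.trans d.symm) (a.trans b.symm)
    · exact n21 (a.symm.trans c)
    · exact n22 (a.symm.trans c)
end

section
/- Let p be an odd prime and k ≥ 1. Fix x = (x_1,…,x_k) ∈ (ZMod p)^k with s := Σ_i x_i ≠ 0. Let r be uniformly distributed on the set of nonzero squares of ZMod p and, independently, let a = (a_1,…,a_k) be uniformly distributed on {a ∈ (ZMod p)^k : Σ_i a_i = 0}. Then the random tuple (r·x_1 + a_1, …, r·x_k + a_k) is uniformly distributed on the set {y ∈ (ZMod p)^k : Σ_i y_i ≠ 0 and (Σ_i y_i is a square in ZMod p iff s is a square in ZMod p)}. In other words, the k-party quadratic character function QCS_k is random-self-reducible. -/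
/-- In `ZMod p`, the quotient of two nonzero elements of the same quadratic character is a square. -/
theorem isSquare_div_of_iff (p : ℕ) [Fact p.Prime] (hp2 : p ≠ 2) (s t : ZMod p)
    (hs : s ≠ 0) (ht : t ≠ 0) (h : IsSquare t ↔ IsSquare s) : IsSquare (t / s) := by
  have hc : ringChar (ZMod p) ≠ 2 := by rwa [ZMod.ringChar_zmod_n]
  by_cases hsq : IsSquare s
  · exact (h.2 hsq).div hsq
  · have htq : ¬ IsSquare t := fun h' => hsq (h.1 h')
    have h1 := (quadraticChar_neg_one_iff_not_isSquare (F := ZMod p)).2 hsq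
    have h2 := (quadraticChar_neg_one_iff_not_isSquare (F := ZMod p)).2 htq
    have h3 : IsSquare (t * s) := by
      rw [← quadraticChar_one_iff_isSquare (mul_ne_zero ht hs), map_mul, h1, h2]
      norm_num
    have h4 : t / s = (t * s) / (s * s) := by field_simp
    rw [h4]
    exact h3.div ⟨s, rfl⟩

/-- The `k`-party quadratic character function `QCS_k` is random-self-reducible.
Fix `x : Fin k → ZMod p` with `s = ∑ x i ≠ 0`.  Sample `r` uniformly from the
nonzero squares of `ZMod p` and, independently, `a` uniformly from the zero-sum
tuples.  Then `(r • x + a)`: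
(1) always lands in the target set
`{y : ∑ y ≠ 0 ∧ (∑ y is a square ↔ s is a square)}`, and
(2) hits every point of the target set equally often (hence it is uniformly
distributed on that set). -/
theorem stmt7 (p : ℕ) (hp : p.Prime) (hp2 : p ≠ 2)
    (k : ℕ) (hk : 1 ≤ k) (x : Fin k → ZMod p) (hs : (∑ i, x i) ≠ 0) :
    (∀ (r : ZMod p) (a : Fin k → ZMod p),
      IsSquare r → r ≠ 0 → (∑ i, a i) = 0 →
      (∑ i, (r * x i + a i)) ≠ 0 ∧
      (IsSquare (∑ i, (r * x i + a i)) ↔ IsSquare (∑ i, x i))) ∧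
    (∀ y₁ y₂ : Fin k → ZMod p,
      ((∑ i, y₁ i) ≠ 0 ∧ (IsSquare (∑ i, y₁ i) ↔ IsSquare (∑ i, x i))) →
      ((∑ i, y₂ i) ≠ 0 ∧ (IsSquare (∑ i, y₂ i) ↔ IsSquare (∑ i, x i))) →
      Nat.card {ra : ZMod p × (Fin k → ZMod p) //
        (IsSquare ra.1 ∧ ra.1 ≠ 0 ∧ (∑ i, ra.2 i) = 0) ∧
        (fun i => ra.1 * x i + ra.2 i) = y₁} =
      Nat.card {ra : ZMod p × (Fin k → ZMod p) //
        (IsSquare ra.1 ∧ ra.1 ≠ 0 ∧ (∑ i, ra.2 i) = 0) ∧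
        (fun i => ra.1 * x i + ra.2 i) = y₂}) := by
  haveI : Fact p.Prime := ⟨hp⟩
  have hsum : ∀ (r : ZMod p) (a : Fin k → ZMod p), (∑ i, a i) = 0 →
      (∑ i, (r * x i + a i)) = r * ∑ i, x i := by
    intro r a ha
    rw [Finset.sum_add_distrib, ha, add_zero, Finset.mul_sum]
  refine ⟨?_, ?_⟩
  · intro r a hr hr0 ha
    rw [hsum r a ha]
    refine ⟨mul_ne_zero hr0 hs, ?_, fun h => hr.mul h⟩
    intro h
    have h1 := h.div hr
    rwa [mul_div_cancel_left₀ _ hr0] at h1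
  · have key : ∀ y : Fin k → ZMod p,
        ((∑ i, y i) ≠ 0 ∧ (IsSquare (∑ i, y i) ↔ IsSquare (∑ i, x i))) →
        Nat.card {ra : ZMod p × (Fin k → ZMod p) //
          (IsSquare ra.1 ∧ ra.1 ≠ 0 ∧ (∑ i, ra.2 i) = 0) ∧
          (fun i => ra.1 * x i + ra.2 i) = y} = 1 := by
      rintro y ⟨hy0, hy⟩
      rw [Nat.card_eq_one_iff_unique]
      constructor
      · constructor
        have hr : ∀ (r : ZMod p) (a : Fin k → ZMod p), (∑ i, a i) = 0 →
            (fun i => r * x i + a i) = y → r = (∑ i, y i) / ∑ i, x i := by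
          intro r a ha h
          rw [eq_div_iff hs, ← hsum r a ha, ← h]
        rintro ⟨⟨r, a⟩, ⟨-, -, ha⟩, h⟩ ⟨⟨r', a'⟩, ⟨-, -, ha'⟩, h'⟩
        have e : r = r' := (hr r a ha h).trans (hr r' a' ha' h').symm
        subst e
        have e2 : a = a' := by
          funext i
          exact add_left_cancel (congrFun (h.trans h'.symm) i)
        subst e2
        rfl
      · refine ⟨⟨((∑ i, y i) / ∑ i, x i, fun i => y i - (∑ i, y i) / (∑ i, x i) * x i),
          ⟨isSquare_div_of_iff p hp2 _ _ hs hy0 hy, div_ne_zero hy0 hs, ?_⟩, ?_⟩⟩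
        · simp only [Finset.sum_sub_distrib, ← Finset.mul_sum]
          rw [div_mul_cancel₀ _ hs, sub_self]
        · funext i
          simp
    intro y₁ y₂ h₁ h₂
    rw [key y₁ h₁, key y₂ h₂]
end

section
/- Let k ≥ 1, fix b ∈ {0,1}, and let F_b be the set of tuples (x_1,…,x_k) of permutations of {1,…,2k} with Jump_k(x_1,…,x_k) = b. Sample permutations π_1,…,π_{k+1} of {1,…,2k} independently and uniformly at random subject to the constraints π_1(1) = 1 and π_{k+1}({1,…,k}) = {1,…,k}. Then for every (x_1,…,x_k) ∈ F_b, the random tuple (π_2 ∘ x_1 ∘ π_1^{-1}, π_3 ∘ x_2 ∘ π_2^{-1}, …, π_{k+1} ∘ x_k ∘ π_k^{-1}) is uniformly distributed on F_b; that is, Jump_k is random-self-reducible. -/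
theorem jump_telescope {G : Type*} [Group G] : ∀ (n : ℕ) (π : Fin (n + 1) → G) (x : Fin n → G),
    (List.ofFn fun i => π i.succ * x i * (π i.castSucc)⁻¹).reverse.prod =
      π (Fin.last n) * (List.ofFn x).reverse.prod * (π 0)⁻¹ := by
  intro n
  induction n with
  | zero => intro π x; simp
  | succ n ih =>
    intro π x
    have h := ih (fun i => π i.succ) (fun i => x i.succ)
    simp only [List.ofFn_succ, List.reverse_cons, List.prod_append, List.prod_singleton]
    simp only [Fin.succ_last, Fin.succ_castSucc] at h
    rw [h]
    simp [mul_assoc]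

theorem jump_exists {G : Type*} [Group G] (n : ℕ) (g : G) (z₁ z₂ : Fin n → G) :
    ∃ σ : Fin (n + 1) → G, σ 0 = g ∧
      ∀ i : Fin n, σ i.succ * z₁ i * (σ i.castSucc)⁻¹ = z₂ i := by
  refine ⟨fun j => Fin.induction (motive := fun _ => G) g
    (fun i s => z₂ i * s * (z₁ i)⁻¹) j, rfl, fun i => ?_⟩
  simp only [Fin.induction_succ]
  group

theorem jump_half_iff {m k : ℕ} (τ : Equiv.Perm (Fin m))
    (h : ∀ j : Fin m, j.val < k → (τ j).val < k) (j : Fin m) :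
    (τ j).val < k ↔ j.val < k := by
  refine ⟨fun hj => ?_, h j⟩
  have := Equiv.Perm.perm_symm_on_of_perm_on_finite (f := τ)
    (p := fun j : Fin m => j.val < k) h hj
  simpa using this


/-- `Jump_k` is random-self-reducible.  Fix `b ∈ {0,1}` and an input
`x = (x_1,…,x_k) ∈ F_b`, i.e. with `(x_k ∘ ⋯ ∘ x_1)(1) ∈ {1,…,k} ↔ b = 0`.
Sample permutations `π_1,…,π_{k+1}` of `{1,…,2k}` uniformly and independently
subject to `π_1(1) = 1` and `π_{k+1}({1,…,k}) = {1,…,k}` (here indexed by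
`Fin (k+1)`, with `π 0 = π_1` and `π (Fin.last k) = π_{k+1}`).  Then the relabelled
tuple `(π_{i+1} ∘ x_i ∘ π_i⁻¹)_i` (1) always lies in `F_b`, and (2) hits every
element of `F_b` equally often, i.e. it is uniformly distributed on `F_b`. -/
theorem stmt9 (k : ℕ) (hk : 1 ≤ k) (b : Bool)
    (x : Fin k → Equiv.Perm (Fin (2 * k)))
    (hxb : ((((List.ofFn x).reverse.prod) (⟨0, by omega⟩ : Fin (2 * k))).val < k)
      ↔ b = false) :
    (∀ π : Fin (k + 1) → Equiv.Perm (Fin (2 * k)),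
      π 0 (⟨0, by omega⟩ : Fin (2 * k)) = (⟨0, by omega⟩ : Fin (2 * k)) →
      (∀ j : Fin (2 * k), j.val < k → ((π (Fin.last k)) j).val < k) →
      ((((List.ofFn fun i => π i.succ * x i * (π i.castSucc)⁻¹).reverse.prod)
          (⟨0, by omega⟩ : Fin (2 * k))).val < k ↔ b = false)) ∧
    (∀ z₁ z₂ : Fin k → Equiv.Perm (Fin (2 * k)),
      ((((List.ofFn z₁).reverse.prod) (⟨0, by omega⟩ : Fin (2 * k))).val < k
        ↔ b = false) →
      ((((List.ofFn z₂).reverse.prod) (⟨0, by omega⟩ : Fin (2 * k))).val < k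
        ↔ b = false) →
      Nat.card {π : Fin (k + 1) → Equiv.Perm (Fin (2 * k)) //
        (π 0 (⟨0, by omega⟩ : Fin (2 * k)) = (⟨0, by omega⟩ : Fin (2 * k)) ∧
          ∀ j : Fin (2 * k), j.val < k → ((π (Fin.last k)) j).val < k) ∧
        (fun i => π i.succ * x i * (π i.castSucc)⁻¹) = z₁} =
      Nat.card {π : Fin (k + 1) → Equiv.Perm (Fin (2 * k)) //
        (π 0 (⟨0, by omega⟩ : Fin (2 * k)) = (⟨0, by omega⟩ : Fin (2 * k)) ∧
          ∀ j : Fin (2 * k), j.val < k → ((π (Fin.last k)) j).val < k) ∧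
        (fun i => π i.succ * x i * (π i.castSucc)⁻¹) = z₂}) := by
  refine ⟨fun π h0 hl => ?_, fun z₁ z₂ h₁ h₂ => ?_⟩
  · rw [jump_telescope, ← hxb]
    have h0' : (π 0)⁻¹ (⟨0, by omega⟩ : Fin (2 * k)) = ⟨0, by omega⟩ := by
      rw [Equiv.Perm.inv_eq_iff_eq, h0]
    rw [Equiv.Perm.mul_apply, Equiv.Perm.mul_apply, h0']
    exact jump_half_iff _ hl _
  · set o : Fin (2 * k) := ⟨0, by omega⟩ with ho
    set Z₁ := (List.ofFn z₁).reverse.prod with hZ₁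
    set Z₂ := (List.ofFn z₂).reverse.prod with hZ₂
    obtain ⟨σ, hσ0, hσ⟩ := jump_exists k (Z₂⁻¹ * Equiv.swap (Z₁ o) (Z₂ o) * Z₁) z₁ z₂
    have hσl : σ (Fin.last k) = Equiv.swap (Z₁ o) (Z₂ o) := by
      have h := jump_telescope k σ z₁
      rw [funext hσ, ← hZ₁, ← hZ₂, hσ0] at h
      have h' : σ (Fin.last k) =
          Z₂ * (Z₂⁻¹ * Equiv.swap (Z₁ o) (Z₂ o) * Z₁) * Z₁⁻¹ := by
        rw [eq_mul_inv_iff_mul_eq] at h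
        rw [h]; group
      rw [h']; group
    have h00 : σ 0 o = o := by
      rw [hσ0]; simp
    have hac : (Z₁ o).val < k ↔ (Z₂ o).val < k := h₁.trans h₂.symm
    have hsw : ∀ j : Fin (2 * k), j.val < k → (σ (Fin.last k) j).val < k := by
      intro j hj
      rw [hσl, Equiv.swap_apply_def]
      split_ifs with ha hb
      · exact hac.1 (ha ▸ hj)
      · exact hac.2 (hb ▸ hj)
      · exact hj
    have hsw' := jump_half_iff _ hsw
    refine Nat.card_congr (Equiv.subtypeEquiv (Equiv.mulLeft σ) fun π => ?_)
    simp only [Equiv.coe_mulLeft, Pi.mul_apply, Equiv.Perm.mul_apply, hsw']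
    refine and_congr (and_congr ?_ Iff.rfl) ?_
    · constructor
      · intro h; rw [h, h00]
      · intro h; exact (σ 0).injective (h.trans h00.symm)
    · rw [funext_iff, funext_iff]
      refine forall_congr' fun i => ?_
      rw [← hσ i]
      have : σ i.succ * π i.succ * x i * (σ i.castSucc * π i.castSucc)⁻¹ =
          σ i.succ * (π i.succ * x i * (π i.castSucc)⁻¹) * (σ i.castSucc)⁻¹ := by group
      rw [this, mul_left_inj, mul_right_inj]
end

section
/- Let g : X × Y → {0,1} with X, Y finite, and let F be an unsatisfiable CSP over a finite variable set vars(F) (no assignment vars(F) → {0,1} satisfies all constraints of F). Define the Raz–McKenzie lift f : {0,1}^N → {0,1}, with coordinates indexed by pairs (C,ℓ) where C is a constraint of F and ℓ : vars(C) → X, by f(z) = 1 iff there is a global labelling ℓ : vars(F) → X such that z_{(C, ℓ↾vars(C))} = 1 for every constraint C. For x : vars(F) → X define a(x) ∈ {0,1}^N by a(x)_{(C,ℓ)} = 1 iff ℓ = x↾vars(C); for y : vars(F) → Y define b(y) ∈ {0,1}^N by b(y)_{(C,ℓ)} = 1 iff C is satisfied by the partial assignment v ↦ g(ℓ(v), y(v))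 for v ∈ vars(C). Then f is monotone, f(a(x)) = 1 for every x, and f(b(y)) = 0 for every y. -/
/-- The Raz–McKenzie lift of an unsatisfiable CSP (given by `cvars` and `sat`):
its input coordinates are indexed by pairs `(C, ℓ)` of a constraint `C` and a
labelling `ℓ : vars(C) → X`, and `f z = 1` iff there is a global labelling
`ℓ : vars(F) → X` whose restrictions pick out only `1`-coordinates of `z`. -/
def RMlift {Var Con : Type*} (cvars : Con → Finset Var) (X : Type*)
    (z : (Σ c : Con, ({v // v ∈ cvars c} → X)) → Bool) : Prop :=
  ∃ ℓ : Var → X, ∀ c : Con, z ⟨c, fun v => ℓ v.val⟩ = true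

/-- Alice's input to the monotone KW-game: `a(x)` has a `1` exactly in the
coordinates `(C, x↾vars(C))`. -/
def RMa {Var Con X : Type*} [DecidableEq Var] [DecidableEq X]
    (cvars : Con → Finset Var) (x : Var → X) :
    (Σ c : Con, ({v // v ∈ cvars c} → X)) → Bool :=
  fun i => decide (i.2 = fun v => x v.val)

/-- Bob's input to the monotone KW-game: `b(y)` has a `1` in coordinate `(C, ℓ)`
iff `C` is satisfied by the partial assignment `v ↦ g (ℓ v) (y v)`. -/
def RMb {Var Con X Y : Type*} (cvars : Con → Finset Var)
    (sat : (c : Con) → ({v // v ∈ cvars c} → Bool) → Bool)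
    (g : X → Y → Bool) (y : Var → Y) :
    (Σ c : Con, ({v // v ∈ cvars c} → X)) → Bool :=
  fun i => sat i.1 fun v => g (i.2 v) (y v.val)

/-- **Raz–McKenzie transformation, basic properties.**  For an unsatisfiable CSP
`F` (given by `cvars`, `sat`) and a gadget `g : X × Y → {0,1}`: the lift `f` is
monotone, `f (a x) = 1` for every `x : vars(F) → X`, and `f (b y) = 0` for every
`y : vars(F) → Y`. -/
theorem stmt11 {Var Con X Y : Type*} [Fintype Var] [Fintype X] [Fintype Y]
    [DecidableEq Var] [DecidableEq X]
    (cvars : Con → Finset Var)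
    (sat : (c : Con) → ({v // v ∈ cvars c} → Bool) → Bool)
    (hunsat : ¬∃ β : Var → Bool, ∀ c : Con, sat c (fun v => β v.val) = true)
    (g : X → Y → Bool) :
    (∀ z z' : (Σ c : Con, ({v // v ∈ cvars c} → X)) → Bool,
      (∀ i, z i ≤ z' i) → RMlift cvars X z → RMlift cvars X z') ∧
    (∀ x : Var → X, RMlift cvars X (RMa cvars x)) ∧
    (∀ y : Var → Y, ¬ RMlift cvars X (RMb cvars sat g y)) := by
  refine ⟨?_, ?_, ?_⟩
  · rintro z z' h ⟨l, hl⟩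
    refine ⟨l, fun c => ?_⟩
    have h1 := h ⟨c, fun v => l v.val⟩
    rw [hl c] at h1
    exact top_le_iff.mp h1
  · intro x
    exact ⟨x, fun c => by simp [RMa]⟩
  · rintro y ⟨l, hl⟩
    exact hunsat ⟨fun v => g (l v) (y v), fun c => hl c⟩
end

section
/- Let g : X × Y → {0,1} be a versatile gadget on finite sets: there are maps e_A : {0,1} → X, e_B : {0,1} → Y with g(e_A(a), e_B(b)) = a ∧ b for all a, b ∈ {0,1}; maps π_A : X → X, π_B : Y → Y with g(π_A(x), π_B(y)) = 1 − g(x,y) for all x, y; and a random variable r together with maps ρ_A, ρ_B such that for every (x,y) the pair (ρ_A(x,r), ρ_B(y,r)) is uniformly distributed on g^{-1}(g(x,y)). Fix α ∈ {0,1}^n, pairwise disjoint blocks B_1,…,B_m ⊆ [n], and for each j ∉ B_1 ∪ ⋯ ∪ B_m a base pair (x°_j, y°_j) ∈ g^{-1}(α_j). Given (a,b) ∈ {0,1}^m × {0,1}^m, define (x,y) ∈ X^n × Y^n by: for j ∈ B_i, (x_j, y_j) = (e_A(a_i), e_B(b_i)) if α_j = 0 and (x_j, y_j) = (π_A(e_A(a_i)),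 π_B(e_B(b_i))) if α_j = 1; for j ∉ ∪_i B_i, (x_j, y_j) = (x°_j, y°_j). Finally set X_j = ρ_A(x_j, r_j) and Y_j = ρ_B(y_j, r_j) where r_1,…,r_n are i.i.d. copies of r. Then: (P1) if a_i ∧ b_i = 0 for all i ∈ [m], the random pair (X,Y) is distributed as μ_α; (P2) if there is exactly one i with a_i = b_i = 1, then (X,Y) is distributed as μ_{α^{B_i}}, where α^{B_i} is α with the coordinates in B_i flipped. -/
theorem card_seeds {X Y R : Type*} (ρA : X → R → X) (ρB : Y → R → Y) {n : ℕ}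
    (x : Fin n → X) (y : Fin n → Y) (u : Fin n → X) (v : Fin n → Y) :
    Nat.card {s : Fin n → R // (∀ j, ρA (x j) (s j) = u j) ∧ (∀ j, ρB (y j) (s j) = v j)} =
      ∏ j, Nat.card {s : R // ρA (x j) s = u j ∧ ρB (y j) s = v j} := by
  rw [← Nat.card_pi]
  refine Nat.card_congr ((Equiv.subtypeEquivRight fun s => ?_).trans
    (Equiv.subtypePiEquivPi (p := fun j s => ρA (x j) s = u j ∧ ρB (y j) s = v j)))
  exact forall_and.symm

/-- **The reduction from unique-disjointness, distributional properties (P1)–(P2).**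
Let `g : X × Y → {0,1}` be a versatile gadget: `g` extends `AND` via embeddings
`(eA, eB)`, is flippable via `(πA, πB)`, and is random-self-reducible via maps
`(ρA, ρB)` driven by a public random seed from a finite set `R` (for every input
`(x,y)` the pair `(ρA x s, ρB y s)`, for uniform `s`, stays in the fiber of
`g (x,y)` and hits each of its points equally often).

Fix `α ∈ {0,1}^n` and pairwise disjoint blocks encoded by `idx : Fin n → Option (Fin m)`
(`idx j = some i` means `j ∈ B_i`), together with base pairs `(xb j, yb j)` encoding
`α j` outside the blocks.  Given `(a, b) ∈ {0,1}^m × {0,1}^m`, form `(x, y)` by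
plugging `(eA (a i), eB (b i))` into the coordinates of block `B_i`, flipped (via
`(πA, πB)`) at coordinates where `α j = 1`, and finally randomise each coordinate
independently with i.i.d. seeds `s j`.  Then:

(P1) if `a i ∧ b i = 0` for all `i`, the resulting random pair is distributed as
`μ_α` (it always encodes `α` and hits every encoding of `α` equally often);

(P2) if there is exactly one `i₀` with `a i₀ = b i₀ = 1`, it is distributed as
`μ_{α^{B_{i₀}}}`, where `α^{B_{i₀}}` flips `α` on the block `B_{i₀}`. -/
theorem stmt14 {X Y R : Type*} [Finite R]
    (g : X → Y → Bool)
    (eA : Bool → X) (eB : Bool → Y)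
    (he : ∀ a b : Bool, g (eA a) (eB b) = (a && b))
    (πA : X → X) (πB : Y → Y)
    (hflip : ∀ x y, g (πA x) (πB y) = !g x y)
    (ρA : X → R → X) (ρB : Y → R → Y)
    (hrsr1 : ∀ (x : X) (y : Y) (s : R), g (ρA x s) (ρB y s) = g x y)
    (hrsr2 : ∀ (x : X) (y : Y) (x₁ : X) (y₁ : Y) (x₂ : X) (y₂ : Y),
      g x₁ y₁ = g x y → g x₂ y₂ = g x y →
      Nat.card {s : R // ρA x s = x₁ ∧ ρB y s = y₁} =
      Nat.card {s : R // ρA x s = x₂ ∧ ρB y s = y₂})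
    {n m : ℕ} (α : Fin n → Bool) (idx : Fin n → Option (Fin m))
    (xb : Fin n → X) (yb : Fin n → Y)
    (hbase : ∀ j, idx j = none → g (xb j) (yb j) = α j)
    (a b : Fin m → Bool)
    (x : Fin n → X) (y : Fin n → Y)
    (hx : ∀ j, x j = match idx j with
      | none => xb j
      | some i => if α j then πA (eA (a i)) else eA (a i))
    (hy : ∀ j, y j = match idx j with
      | none => yb j
      | some i => if α j then πB (eB (b i)) else eB (b i)) :
    ((∀ i, (a i && b i) = false) →
      ((∀ (s : Fin n → R) (j : Fin n), g (ρA (x j) (s j)) (ρB (y j) (s j)) = α j) ∧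
       (∀ (u₁ : Fin n → X) (v₁ : Fin n → Y) (u₂ : Fin n → X) (v₂ : Fin n → Y),
         (∀ j, g (u₁ j) (v₁ j) = α j) → (∀ j, g (u₂ j) (v₂ j) = α j) →
         Nat.card {s : Fin n → R //
           (∀ j, ρA (x j) (s j) = u₁ j) ∧ (∀ j, ρB (y j) (s j) = v₁ j)} =
         Nat.card {s : Fin n → R //
           (∀ j, ρA (x j) (s j) = u₂ j) ∧ (∀ j, ρB (y j) (s j) = v₂ j)}))) ∧
    (∀ i₀ : Fin m, a i₀ = true → b i₀ = true →
      (∀ i, i ≠ i₀ → (a i && b i) = false) →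
      ((∀ (s : Fin n → R) (j : Fin n),
          g (ρA (x j) (s j)) (ρB (y j) (s j)) =
            (if idx j = some i₀ then !α j else α j)) ∧
       (∀ (u₁ : Fin n → X) (v₁ : Fin n → Y) (u₂ : Fin n → X) (v₂ : Fin n → Y),
         (∀ j, g (u₁ j) (v₁ j) = (if idx j = some i₀ then !α j else α j)) →
         (∀ j, g (u₂ j) (v₂ j) = (if idx j = some i₀ then !α j else α j)) →
         Nat.card {s : Fin n → R //
           (∀ j, ρA (x j) (s j) = u₁ j) ∧ (∀ j, ρB (y j) (s j) = v₁ j)} =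
         Nat.card {s : Fin n → R //
           (∀ j, ρA (x j) (s j) = u₂ j) ∧ (∀ j, ρB (y j) (s j) = v₂ j)}))) := by
  have key : ∀ β : Fin n → Bool, (∀ j, g (x j) (y j) = β j) →
      ((∀ (s : Fin n → R) (j : Fin n), g (ρA (x j) (s j)) (ρB (y j) (s j)) = β j) ∧
       (∀ (u₁ : Fin n → X) (v₁ : Fin n → Y) (u₂ : Fin n → X) (v₂ : Fin n → Y),
         (∀ j, g (u₁ j) (v₁ j) = β j) → (∀ j, g (u₂ j) (v₂ j) = β j) →
         Nat.card {s : Fin n → R //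
           (∀ j, ρA (x j) (s j) = u₁ j) ∧ (∀ j, ρB (y j) (s j) = v₁ j)} =
         Nat.card {s : Fin n → R //
           (∀ j, ρA (x j) (s j) = u₂ j) ∧ (∀ j, ρB (y j) (s j) = v₂ j)})) := by
    intro β hβ
    refine ⟨fun s j => by rw [hrsr1, hβ], fun u₁ v₁ u₂ v₂ h₁ h₂ => ?_⟩
    rw [card_seeds, card_seeds]
    refine Finset.prod_congr rfl fun j _ => hrsr2 _ _ _ _ _ _ ?_ ?_
    · rw [h₁, hβ]
    · rw [h₂, hβ]
  have hg : ∀ j, g (x j) (y j) = match idx j with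
      | none => α j
      | some i => xor (α j) (a i && b i) := by
    intro j
    rw [hx, hy]
    cases h : idx j with
    | none => exact hbase j h
    | some i => cases hα : α j <;> simp [he, hflip]
  refine ⟨fun h => key α fun j => ?_, fun i₀ ha hb h => key _ fun j => ?_⟩
  · rw [hg]
    cases hi : idx j with
    | none => rfl
    | some i => simp [h i]
  · rw [hg]
    cases hi : idx j with
    | none => simp
    | some i =>
      by_cases hii : i = i₀
      · subst hii; simp [ha, hb]
      · simp [h i hii, hii]
end

section
/- Let r ≥ 1 be odd and L ≥ 1. Let v ∈ (ZMod r)^3, let b_1,…,b_L ∈ (ZMod r)^3, and define the walk p(j) = v + Σ_{t<j} b_t for j ∈ {1,…,L+1}. Suppose i ≥ 2 is such that p(j) ≠ p(i) for all j < i (layer i is the first visit to the vertex p(i)). Define the mirrored walk q(j) = p(i) + Σ_{t=j}^{i−1} b_t for 1 ≤ j ≤ i. Then q(j) ≠ p(j) for every j < i. Consequently, the mirrored walks obtained from distinct first-visit layers give at least |{p(1),…,p(L+1)}| − 1 distinct paths paired with p. -/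
theorem mirror_two_cancel (r : ℕ) (hr : Odd r) (x y : Fin 3 → ZMod r)
    (h : y + (y - x) = x) : x = y := by
  obtain ⟨k, hk⟩ := hr
  funext c
  have hc : y c + (y c - x c) = x c := congrFun h c
  have h0 : ((2 * k + 1 : ℕ) : ZMod r) = 0 := by
    rw [← hk]; exact ZMod.natCast_self r
  push_cast at h0
  linear_combination (x c - y c) * h0 + (k : ZMod r) * hc

/-- **Mirrored walks are disjoint from the original walk before the pairing layer.**
Let `r` be odd and let `p` be a walk of length `L` in `(ZMod r)³` starting at `v`
with steps `bstep`, i.e. `p j = v + ∑_{1 ≤ t < j} bstep t` for layers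
`j ∈ {1,…,L+1}`.  Suppose layer `i ≥ 2` is the first visit of `p` to the vertex
`p i`.  Let `q` be the mirrored walk, `q j = p i + ∑_{j ≤ t < i} bstep t`.  Then
`q j ≠ p j` for all layers `1 ≤ j < i`.  Moreover, the map sending a first-visit
layer `i'` to its mirrored walk is injective on the set of first-visit layers, and
the number of first-visit layers in `{2,…,L+1}` is at least `|π(p)| − 1`, where
`π(p)` is the set of vertices visited by `p`; hence distinct first-visit layers
give at least `|π(p)| − 1` distinct walks paired with `p`. -/
theorem stmt15 (r : ℕ) (hr : Odd r) (L : ℕ) (hL : 1 ≤ L)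
    (v : Fin 3 → ZMod r) (bstep : ℕ → (Fin 3 → ZMod r))
    (p : ℕ → (Fin 3 → ZMod r))
    (hp : ∀ j, 1 ≤ j → p j = v + ∑ t ∈ Finset.Ico 1 j, bstep t)
    (i : ℕ) (hi2 : 2 ≤ i) (hiL : i ≤ L + 1)
    (hfirst : ∀ j, 1 ≤ j → j < i → p j ≠ p i)
    (q : ℕ → (Fin 3 → ZMod r))
    (hq : ∀ j, 1 ≤ j → j ≤ i → q j = p i + ∑ t ∈ Finset.Ico j i, bstep t) :
    (∀ j, 1 ≤ j → j < i → q j ≠ p j) ∧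
    Set.InjOn
      (fun i' : ℕ => fun j : ℕ =>
        if 1 ≤ j ∧ j ≤ i' then p i' + ∑ t ∈ Finset.Ico j i', bstep t else p j)
      {i' | 2 ≤ i' ∧ i' ≤ L + 1 ∧ ∀ j, 1 ≤ j → j < i' → p j ≠ p i'} ∧
    (p '' Set.Icc 1 (L + 1)).ncard - 1 ≤
      {i' | 2 ≤ i' ∧ i' ≤ L + 1 ∧ ∀ j, 1 ≤ j → j < i' → p j ≠ p i'}.ncard := by
  have hstep : ∀ j k, 1 ≤ j → j ≤ k → ∑ t ∈ Finset.Ico j k, bstep t = p k - p j := by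
    intro j k hj hjk
    rw [hp j hj, hp k (hj.trans hjk), ← Finset.sum_Ico_consecutive bstep hj hjk]
    abel
  refine ⟨?_, ?_, ?_⟩
  · intro j hj hji h
    rw [hq j hj hji.le, hstep j i hj hji.le] at h
    exact hfirst j hj hji (mirror_two_cancel r hr _ _ h)
  · have key : ∀ a b, 2 ≤ a → a < b → (∀ j, 1 ≤ j → j < b → p j ≠ p b) →
        (fun j : ℕ =>
          if 1 ≤ j ∧ j ≤ a then p a + ∑ t ∈ Finset.Ico j a, bstep t else p j) =
        (fun j : ℕ =>
          if 1 ≤ j ∧ j ≤ b then p b + ∑ t ∈ Finset.Ico j b, bstep t else p j) → False := by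
      intro a b ha hab hb h
      have h1 : 1 ≤ a := by omega
      have h2 := congrFun h a
      simp only [h1, le_refl, hab.le, and_self, if_true, Finset.Ico_self, Finset.sum_empty,
        add_zero] at h2
      rw [hstep a b h1 hab.le] at h2
      exact hb a h1 hab (mirror_two_cancel r hr _ _ h2.symm)
    intro a ha b hb h
    rcases lt_trichotomy a b with hab | hab | hab
    · exact (key a b ha.1 hab hb.2.2 h).elim
    · exact hab
    · exact (key b a hb.1 hab ha.2.2 h.symm).elim
  · set S : Set ℕ := {i' | 2 ≤ i' ∧ i' ≤ L + 1 ∧ ∀ j, 1 ≤ j → j < i' → p j ≠ p i'} with hS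
    have hfin : S.Finite := (Set.finite_Icc 2 (L + 1)).subset fun x hx => ⟨hx.1, hx.2.1⟩
    have hsub : p '' Set.Icc 1 (L + 1) ⊆ insert (p 1) (p '' S) := by
      rintro _ ⟨k, ⟨hk1, hkL⟩, rfl⟩
      induction k using Nat.strong_induction_on with
      | _ k ih =>
        by_cases hk : k = 1
        · subst hk; exact Set.mem_insert _ _
        by_cases hf : ∀ j, 1 ≤ j → j < k → p j ≠ p k
        · exact Set.mem_insert_of_mem _ ⟨k, ⟨by omega, hkL, hf⟩, rfl⟩
        · push Not at hf
          obtain ⟨j, hj1, hjk, he⟩ := hf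
          rw [← he]
          exact ih j hjk hj1 (by omega)
    have h1 := Set.ncard_le_ncard hsub ((hfin.image p).insert _)
    have h2 := Set.ncard_insert_le (p 1) (p '' S)
    have h3 := Set.ncard_image_le (f := p) hfin
    omega
end

section
/- Let r ≥ 1 be odd and L ≥ 1, and let p be a walk in (ZMod r)^3 with steps b_1,…,b_L, i.e., p(j) = p(1) + Σ_{t<j} b_t. Let 2 ≤ i < i' and suppose p(i) ≠ p(i'). Let q and q' be the mirrored walks paired with p at layers i and i' respectively, i.e., q(j) = p(i) + Σ_{t=j}^{i−1} b_t for j ≤ i and q(j) = p(j) for j ≥ i, and similarly for q' with i'. Then the sets of layered nodes {(q(j), j) : j < i, q(j) ≠ p(j)} and {(q'(j), j) : j < i', q'(j) ≠ p(j)} are disjoint. That is, the blocks q ∖ p and q' ∖ p of distinct mirrored pairings at distinct first-visit vertices are pairwise disjoint. -/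
/-- **Blocks of distinct mirrored pairings are pairwise disjoint.**
Let `r` be odd and let `p` be a walk in `(ZMod r)³` with steps `bstep`
(`p j = p 1 + ∑_{1 ≤ t < j} bstep t`).  Let `2 ≤ i < i'` with `p i ≠ p i'`, and
let `q`, `q'` be the mirrored walks paired with `p` at layers `i` and `i'`
respectively (`q j = p i + ∑_{j ≤ t < i} bstep t` for `j ≤ i`, `q j = p j` for
`j ≥ i`, and similarly for `q'`).  Then the blocks
`{(q j, j) : 1 ≤ j < i, q j ≠ p j}` and `{(q' j, j) : 1 ≤ j < i', q' j ≠ p j}`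
of layered nodes are disjoint. -/
theorem stmt16 (r : ℕ) (hr : Odd r) (L : ℕ) (hL : 1 ≤ L)
    (bstep : ℕ → (Fin 3 → ZMod r)) (p : ℕ → (Fin 3 → ZMod r))
    (hp : ∀ j, 1 ≤ j → p j = p 1 + ∑ t ∈ Finset.Ico 1 j, bstep t)
    (i i' : ℕ) (hi2 : 2 ≤ i) (hii' : i < i') (hi'L : i' ≤ L + 1)
    (hne : p i ≠ p i')
    (q q' : ℕ → (Fin 3 → ZMod r))
    (hq : ∀ j, 1 ≤ j → j ≤ i → q j = p i + ∑ t ∈ Finset.Ico j i, bstep t)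
    (hq2 : ∀ j, i ≤ j → q j = p j)
    (hq' : ∀ j, 1 ≤ j → j ≤ i' → q' j = p i' + ∑ t ∈ Finset.Ico j i', bstep t)
    (hq'2 : ∀ j, i' ≤ j → q' j = p j) :
    Disjoint
      {x : (Fin 3 → ZMod r) × ℕ | ∃ j, 1 ≤ j ∧ j < i ∧ q j ≠ p j ∧ x = (q j, j)}
      {x : (Fin 3 → ZMod r) × ℕ | ∃ j, 1 ≤ j ∧ j < i' ∧ q' j ≠ p j ∧ x = (q' j, j)} := by
  have key : ∀ j k, 1 ≤ j → j ≤ k → ∑ t ∈ Finset.Ico j k, bstep t = p k - p j := by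
    intro j k hj hjk
    rw [hp k (hj.trans hjk), hp j hj, ← Finset.sum_Ico_consecutive bstep hj hjk]
    abel
  rw [Set.disjoint_left]
  rintro x ⟨j, hj1, hji, -, rfl⟩ ⟨k, -, -, -, hx⟩
  obtain ⟨h1, rfl⟩ := Prod.mk.inj hx
  rw [hq j hj1 hji.le, hq' j hj1 (hji.trans hii').le, key j i hj1 hji.le,
    key j i' hj1 (hji.trans hii').le] at h1
  apply hne
  have hu : IsUnit (2 : ZMod r) := by
    have h := (ZMod.isUnit_iff_coprime 2 r).2 (Nat.coprime_two_left.2 hr)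
    exact_mod_cast h
  funext c
  have h2 := congrFun h1 c
  simp only [Pi.add_apply, Pi.sub_apply] at h2
  apply hu.mul_left_cancel
  linear_combination h2
end

section
/- Let r ≥ 3 be odd, m = r^3, and ℓ ≥ 2. Let G be the layered directed acyclic graph with vertex set (ZMod r)^3 × {1,…,ℓ}, an edge from (v,i) to (u,i+1) iff u − v ∈ B where B = {±e_1, ±e_2, ±e_3} ⊆ (ZMod r)^3, and a fixed sink t = (t_H, ℓ). Suppose that at least half of the source–sink paths p of G ending at t satisfy |π(p)| ≥ m/2, where π(p) is the set of first coordinates of the nodes of p. Then for every total function f solving the pebbling search problem S(Peb_G), there exists a source–sink path p such that α_p is a critical input (its unique feasible solution is the source of p) and the block sensitivity of f at α_p is at least m/8 − 1. -/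
/-- Vertices of the 3-dimensional grid group `H = (ZMod r)³`. -/
abbrev GridH (r : ℕ) := Fin 3 → ZMod r

/-- The six generators `±e₁, ±e₂, ±e₃` of the Cayley graph `H`. -/
def genSet (r : ℕ) : Set (GridH r) :=
  {u | ∃ c : Fin 3, u = (fun j => if j = c then 1 else 0) ∨
                    u = (fun j => if j = c then -1 else 0)}

/-- A source–sink path of the layered graph `G = H × P` (with `L + 2` layers),
ending at the sink `(tH, ℓ)`: a sequence of vertices of `H`, one per layer,
each step lying in the generator set, with last vertex `tH`. -/
def isSSPath (r L : ℕ) (tH : GridH r) (p : Fin (L + 2) → GridH r) : Prop :=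
  p (Fin.last (L + 1)) = tH ∧
  ∀ i : Fin (L + 1), p i.succ - p i.castSucc ∈ genSet r

/-- The critical assignment `α_p` associated with a source–sink path `p`:
`0` exactly on the nodes of `p`, and `1` elsewhere. -/
def pathAssign (r L : ℕ) (p : Fin (L + 2) → GridH r) :
    GridH r × Fin (L + 2) → Bool :=
  fun u => decide (u.1 ≠ p u.2)

/-- The edge relation of the layered graph `G`: there is an edge from `(v, i)` to
`(u, i + 1)` iff `u - v` is a generator. -/
def edgeRel (r L : ℕ) (w u : GridH r × Fin (L + 2)) : Prop :=
  (u.2 : ℕ) = (w.2 : ℕ) + 1 ∧ u.1 - w.1 ∈ genSet r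

/-- Feasible solutions of the pebbling search problem `S(Peb_G)`: on input `α`,
the solution `none` stands for the violated sink constraint (`α t = 1`), and
`some u` for a violated node constraint (`α u = 0` with all in-neighbours of `u`
true). -/
def pebFeasible (r L : ℕ) (tH : GridH r) (α : GridH r × Fin (L + 2) → Bool) :
    Option (GridH r × Fin (L + 2)) → Prop
  | none => α (tH, Fin.last (L + 1)) = true
  | some u => α u = false ∧ ∀ w, edgeRel r L w u → α w = true

open Classical in
/-- Reflect the part of `p` before layer `i` through `p i`. -/
noncomputable def reflP (r L : ℕ) (i : Fin (L + 2)) (p : Fin (L + 2) → GridH r) :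
    Fin (L + 2) → GridH r :=
  fun j => if j < i then p i + p i - p j else p j

/-- `i` is a first visit of `p i`, and not the first layer. -/
def firstV (r L : ℕ) (i : Fin (L + 2)) (p : Fin (L + 2) → GridH r) : Prop :=
  0 < i ∧ ∀ j < i, p j ≠ p i

/-- The assignment with zeros on `p` and its reflection. -/
noncomputable def mergeA (r L : ℕ) (i : Fin (L + 2)) (p : Fin (L + 2) → GridH r) :
    GridH r × Fin (L + 2) → Bool :=
  fun u => decide (u.1 ≠ p u.2 ∧ u.1 ≠ reflP r L i p u.2)

lemma double_inj (r : ℕ) (hr : Odd r) (x y : GridH r) (h : x + x = y + y) : x = y := by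
  funext c
  have h1 := congrFun h c
  simp only [Pi.add_apply] at h1
  have hu : IsUnit ((2 : ℕ) : ZMod r) := by
    rw [ZMod.isUnit_iff_coprime]
    exact (Nat.coprime_two_left).2 hr
  apply hu.mul_left_cancel
  push_cast
  linear_combination h1

lemma genSet_neg (r : ℕ) (u : GridH r) (h : u ∈ genSet r) : -u ∈ genSet r := by
  obtain ⟨c, h | h⟩ := h
  · refine ⟨c, Or.inr ?_⟩
    subst h; funext j; by_cases hj : j = c <;> simp [hj]
  · refine ⟨c, Or.inl ?_⟩
    subst h; funext j; by_cases hj : j = c <;> simp [hj]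

lemma reflP_refl (r L : ℕ) (i : Fin (L + 2)) (p : Fin (L + 2) → GridH r) :
    reflP r L i (reflP r L i p) = p := by
  funext j
  unfold reflP
  by_cases h : j < i <;> simp [h]

lemma reflP_path (r L : ℕ) (tH : GridH r) (i : Fin (L + 2)) (p : Fin (L + 2) → GridH r)
    (h : isSSPath r L tH p) : isSSPath r L tH (reflP r L i p) := by
  constructor
  · unfold reflP
    rw [if_neg (not_lt.2 (Fin.le_last i))]
    exact h.1
  · intro j
    have h2 := h.2 j
    unfold reflP
    by_cases h1 : j.succ < i
    · have h3 : j.castSucc < i := lt_trans (Fin.castSucc_lt_succ) h1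
      rw [if_pos h1, if_pos h3]
      have := genSet_neg r _ h2
      convert this using 1
      abel
    · rw [if_neg h1]
      by_cases h3 : j.castSucc < i
      · rw [if_pos h3]
        have : j.succ = i := le_antisymm (Fin.castSucc_lt_iff_succ_le.1 h3) (not_lt.1 h1)
        rw [this] at h2 ⊢
        have := genSet_neg r _ h2
        convert this using 1
        abel
      · rw [if_neg h3]; exact h2

lemma reflP_firstV (r L : ℕ) (i : Fin (L + 2)) (p : Fin (L + 2) → GridH r)
    (h : firstV r L i p) : firstV r L i (reflP r L i p) := by
  refine ⟨h.1, fun j hj he => h.2 j hj ?_⟩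
  unfold reflP at he
  rw [if_pos hj, if_neg (lt_irrefl i)] at he
  have : p i - p j = 0 := by
    have h4 : p i + p i - p j - p i = 0 := by rw [he]; abel
    rw [← h4]; abel
  exact (sub_eq_zero.1 this).symm

lemma reflP_ne (r L : ℕ) (hr : Odd r) (i : Fin (L + 2)) (p : Fin (L + 2) → GridH r)
    (h : firstV r L i p) (j : Fin (L + 2)) (hj : j < i) : reflP r L i p j ≠ p j := by
  intro he
  unfold reflP at he
  rw [if_pos hj] at he
  exact h.2 j hj (double_inj r hr _ _ (sub_eq_iff_eq_add.1 he).symm)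

lemma mergeA_refl (r L : ℕ) (i : Fin (L + 2)) (p : Fin (L + 2) → GridH r) :
    mergeA r L i (reflP r L i p) = mergeA r L i p := by
  funext u
  unfold mergeA
  rw [reflP_refl]
  simp only [and_comm]

lemma crit (r L : ℕ) (tH : GridH r) (p : Fin (L + 2) → GridH r) (h : isSSPath r L tH p) :
    ∀ s, pebFeasible r L tH (pathAssign r L p) s ↔ s = some (p 0, 0) := by
  intro s
  cases s with
  | none => simp [pebFeasible, pathAssign, h.1]
  | some u =>
    obtain ⟨v, j⟩ := u
    constructor
    · rintro ⟨h1, h2⟩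
      have hv : v = p j := by simpa [pathAssign] using h1
      subst hv
      induction j using Fin.cases with
      | zero => rfl
      | succ k =>
        have := h2 (p k.castSucc, k.castSucc) ⟨by simp, h.2 k⟩
        simp [pathAssign] at this
    · intro he
      simp only [Option.some.injEq, Prod.mk.injEq] at he
      obtain ⟨rfl, rfl⟩ := he
      refine ⟨by simp [pathAssign], fun w hw => ?_⟩
      have := hw.1
      simp at this

lemma exists_path (r L : ℕ) (tH : GridH r) : ∃ p, isSSPath r L tH p := by
  refine ⟨fun j c => tH c + if c = 0 then ((j : ℕ) : ZMod r) - ((L + 1 : ℕ) : ZMod r) else 0, ?_, ?_⟩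
  · funext c
    simp
  · intro i
    refine ⟨0, Or.inl ?_⟩
    funext c
    by_cases hc : c = 0 <;> simp [hc]

lemma flip_eq (r L : ℕ) (hr : Odd r) (i : Fin (L + 2)) (p : Fin (L + 2) → GridH r)
    (h : firstV r L i p) (B : Finset (GridH r × Fin (L + 2)))
    (hB : ∀ u, u ∈ B ↔ u.2 < i ∧ u.1 = reflP r L i p u.2) :
    (fun u => if u ∈ B then !(pathAssign r L p u) else pathAssign r L p u) = mergeA r L i p := by
  funext u
  obtain ⟨v, j⟩ := u
  by_cases hu : (v, j) ∈ B
  · have h2 := (hB _).1 hu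
    simp only at h2
    have h3 := reflP_ne r L hr i p h j h2.1
    rw [if_pos hu]
    simp [pathAssign, mergeA, h2.2, h3]
  · rw [if_neg hu]
    rw [hB] at hu
    simp only at hu
    by_cases hj : j < i
    · have : v ≠ reflP r L i p j := fun h => hu ⟨hj, h⟩
      simp [pathAssign, mergeA, this]
    · have : reflP r L i p j = p j := by simp [reflP, hj]
      simp [pathAssign, mergeA, this]

open Classical in
lemma image_le (r L : ℕ) (p : Fin (L + 2) → GridH r) :
    (Finset.univ.image p).card ≤ (Finset.univ.filter fun i => firstV r L i p).card + 1 := by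
  have hsub : Finset.univ.image p ⊆
      insert (p 0) ((Finset.univ.filter fun i => firstV r L i p).image p) := by
    intro v hv
    obtain ⟨j, -, hj⟩ := Finset.mem_image.1 hv
    have hex : (Finset.univ.filter fun k => p k = v).Nonempty := ⟨j, by simp [hj]⟩
    obtain ⟨k, hk, hmin⟩ := Finset.exists_min_image _ id hex
    have hk' : p k = v := by simpa using hk
    rw [Finset.mem_insert]
    by_cases h0 : k = 0
    · left; rw [← hk', h0]
    · right
      refine Finset.mem_image.2 ⟨k, ?_, hk'⟩
      simp only [Finset.mem_filter, Finset.mem_univ, true_and]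
      refine ⟨Fin.pos_iff_ne_zero.2 h0, fun l hl he => ?_⟩
      have := hmin l (by simp [he, hk'])
      exact absurd hl (not_lt.2 this)
  calc _ ≤ _ := Finset.card_le_card hsub
    _ ≤ _ := Finset.card_insert_le _ _
    _ ≤ _ := Nat.add_le_add_right Finset.card_image_le _

open Classical in
lemma count (r L : ℕ) [NeZero r] (hr : Odd r) (tH : GridH r)
    (hhalf : Nat.card {p : Fin (L + 2) → GridH r // isSSPath r L tH p} ≤
      2 * Nat.card {p : Fin (L + 2) → GridH r //
        isSSPath r L tH p ∧ r ^ 3 ≤ 2 * (Finset.univ.image p).card})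
    (f : (GridH r × Fin (L + 2) → Bool) → Option (GridH r × Fin (L + 2))) :
    ∃ p, isSSPath r L tH p ∧ r ^ 3 ≤ 8 * ((Finset.univ.filter fun i =>
      firstV r L i p ∧ f (mergeA r L i p) ≠ some (p 0, 0)).card + 1) := by
  set P : Finset (Fin (L + 2) → GridH r) := Finset.univ.filter fun p => isSSPath r L tH p with hP
  set S : (Fin (L + 2) → GridH r) → Finset (Fin (L + 2)) := fun p => Finset.univ.filter fun i =>
      firstV r L i p ∧ f (mergeA r L i p) ≠ some (p 0, 0) with hS
  set V : (Fin (L + 2) → GridH r) → Finset (Fin (L + 2)) := fun p => Finset.univ.filter fun i =>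
      firstV r L i p with hV
  have hc1 : Nat.card {p : Fin (L + 2) → GridH r // isSSPath r L tH p} = P.card := by
    rw [Nat.card_eq_fintype_card, Fintype.card_subtype]
  set Q := P.filter fun p => r ^ 3 ≤ 2 * (Finset.univ.image p).card with hQ
  have hc2 : Nat.card {p : Fin (L + 2) → GridH r //
        isSSPath r L tH p ∧ r ^ 3 ≤ 2 * (Finset.univ.image p).card} = Q.card := by
    rw [Nat.card_eq_fintype_card, Fintype.card_subtype, hQ, hP, Finset.filter_filter]
  rw [hc1, hc2] at hhalf
  have hVS : ∑ p ∈ P, (V p).card ≤ 2 * ∑ p ∈ P, (S p).card := by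
    have e1 : ∑ p ∈ P, (V p).card =
        ∑ i : Fin (L + 2), (P.filter fun p => firstV r L i p).card := by
      simp only [hV, Finset.card_filter]
      exact Finset.sum_comm
    have e2 : ∑ p ∈ P, (S p).card =
        ∑ i : Fin (L + 2), (P.filter fun p =>
          firstV r L i p ∧ f (mergeA r L i p) ≠ some (p 0, 0)).card := by
      simp only [hS, Finset.card_filter]
      exact Finset.sum_comm
    rw [e1, e2, Finset.mul_sum]
    refine Finset.sum_le_sum fun i _ => ?_
    set T := P.filter fun p => firstV r L i p ∧ f (mergeA r L i p) ≠ some (p 0, 0) with hT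
    have hsub : (P.filter fun p => firstV r L i p) ⊆ T ∪ T.image (reflP r L i) := by
      intro p hp
      simp only [hP, Finset.mem_filter, Finset.mem_univ, true_and] at hp
      rw [Finset.mem_union]
      by_cases h : f (mergeA r L i p) = some (p 0, 0)
      · right
        refine Finset.mem_image.2 ⟨reflP r L i p, ?_, reflP_refl r L i p⟩
        simp only [hT, hP, Finset.mem_filter, Finset.mem_univ, true_and]
        refine ⟨reflP_path r L tH i p hp.1, reflP_firstV r L i p hp.2, ?_⟩
        rw [mergeA_refl, h]
        intro he
        simp only [Option.some.injEq, Prod.mk.injEq, and_true] at he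
        exact reflP_ne r L hr i p hp.2 0 hp.2.1 he.symm
      · left
        simp only [hT, hP, Finset.mem_filter, Finset.mem_univ, true_and]
        exact ⟨hp.1, hp.2, h⟩
    calc _ ≤ _ := Finset.card_le_card hsub
      _ ≤ _ := Finset.card_union_le _ _
      _ ≤ T.card + T.card := Nat.add_le_add_left Finset.card_image_le _
      _ = _ := by ring
  have hQ1 : Q.card * r ^ 3 ≤ ∑ p ∈ P, 2 * ((V p).card + 1) := by
    calc Q.card * r ^ 3 = ∑ p ∈ Q, r ^ 3 := by simp
      _ ≤ ∑ p ∈ Q, 2 * ((V p).card + 1) := by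
        refine Finset.sum_le_sum fun p hp => ?_
        have h1 := (Finset.mem_filter.1 hp).2
        have h2 : (Finset.univ.image p).card ≤ (V p).card + 1 := by
          convert image_le r L p
        exact h1.trans (Nat.mul_le_mul_left _ (by convert h2))
      _ ≤ _ := Finset.sum_le_sum_of_subset (Finset.filter_subset _ _)
  by_contra! hcon
  have hne : P.Nonempty := by
    obtain ⟨p, hp⟩ := exists_path r L tH
    exact ⟨p, by simp [hP, hp]⟩
  have hlt : ∑ p ∈ P, 8 * ((S p).card + 1) < ∑ p ∈ P, r ^ 3 := by
    refine Finset.sum_lt_sum_of_nonempty hne fun p hp => ?_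
    exact hcon p (by simpa [hP] using hp)
  simp only [← Finset.mul_sum, Finset.sum_add_distrib, Finset.sum_const, smul_eq_mul, mul_one]
    at hlt hQ1
  have h5 := Nat.mul_le_mul_right (r ^ 3) hhalf
  nlinarith

/-- **Pebbling sensitivity.**  Let `r ≥ 3` be odd, `m = r³`, and let `G` be the
layered graph `H × P` with `L + 2 ≥ 2` layers and sink `t = (tH, ℓ)`.  Assume at
least half of the source–sink paths `p` satisfy `|π(p)| ≥ m/2`, where `π(p)` is
the projection of `p` to `H`.  Then for every total function `f` solving
`S(Peb_G)` there is a source–sink path `p` such that `α_p` is a critical input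
(its unique feasible solution is the source constraint of `p`) and the block
sensitivity of `f` at `α_p` is at least `m/8 − 1`: there are `b` pairwise
disjoint nonempty blocks with `b ≥ m/8 − 1`, flipping any one of which changes
the value of `f`. -/
theorem stmt17 (r L : ℕ) (hr : Odd r) (hr3 : 3 ≤ r) (tH : GridH r)
    (hhalf : Nat.card {p : Fin (L + 2) → GridH r // isSSPath r L tH p} ≤
      2 * Nat.card {p : Fin (L + 2) → GridH r //
        isSSPath r L tH p ∧ r ^ 3 ≤ 2 * (Finset.univ.image p).card})
    (f : (GridH r × Fin (L + 2) → Bool) → Option (GridH r × Fin (L + 2)))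
    (hf : ∀ α, pebFeasible r L tH α (f α)) :
    ∃ p : Fin (L + 2) → GridH r, isSSPath r L tH p ∧
      (∀ s, pebFeasible r L tH (pathAssign r L p) s ↔ s = some (p 0, 0)) ∧
      ∃ (b : ℕ) (B : Fin b → Finset (GridH r × Fin (L + 2))),
        r ^ 3 ≤ 8 * (b + 1) ∧
        (∀ i, (B i).Nonempty) ∧
        (∀ i j, i ≠ j → Disjoint (B i) (B j)) ∧
        (∀ i,
          f (fun u => if u ∈ B i then !(pathAssign r L p u) else pathAssign r L p u)
            ≠ f (pathAssign r L p)) := by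
  haveI : NeZero r := ⟨by omega⟩
  classical
  obtain ⟨p, hp, hcard⟩ := count r L hr tH hhalf f
  refine ⟨p, hp, crit r L tH p hp, ?_⟩
  set S := Finset.univ.filter fun i =>
      firstV r L i p ∧ f (mergeA r L i p) ≠ some (p 0, 0) with hS
  let e := S.equivFin.symm
  have he : ∀ k, firstV r L (e k).1 p ∧ f (mergeA r L (e k).1 p) ≠ some (p 0, 0) := fun k =>
    (Finset.mem_filter.1 (e k).2).2
  let B : Fin S.card → Finset (GridH r × Fin (L + 2)) := fun k =>
    Finset.univ.filter fun u => u.2 < (e k).1 ∧ u.1 = reflP r L (e k).1 p u.2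
  have hB : ∀ k u, u ∈ B k ↔ u.2 < (e k).1 ∧ u.1 = reflP r L (e k).1 p u.2 := by
    intro k u; simp [B]
  refine ⟨S.card, B, hcard, ?_, ?_, ?_⟩
  · intro k
    exact ⟨(reflP r L (e k).1 p 0, 0), (hB _ _).2 ⟨(he k).1.1, rfl⟩⟩
  · intro k l hkl
    rw [Finset.disjoint_left]
    intro u hu hu'
    rw [hB] at hu hu'
    have h1 := hu.2.symm.trans hu'.2
    unfold reflP at h1
    rw [if_pos hu.1, if_pos hu'.1] at h1
    have h2 := double_inj r hr _ _ (sub_left_injective h1)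
    apply hkl
    apply e.injective
    apply Subtype.ext
    rcases lt_trichotomy (e k).1 (e l).1 with h | h | h
    · exact absurd h2 ((he l).1.2 _ h)
    · exact h
    · exact absurd h2.symm ((he k).1.2 _ h)
  · intro k
    have h1 : f (pathAssign r L p) = some (p 0, 0) := (crit r L tH p hp _).1 (hf _)
    rw [h1]
    have h2 := flip_eq r L hr (e k).1 p (he k).1 (B k) (hB k)
    intro h3
    apply (he k).2
    rw [← h3, ← h2]
end
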